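/- arXiv:2309.13290 — 5 statements merged into one kernel-verified Lean document; each statement's English description precedes it below -/
import Mathlib

section
/- Let (X,d) be a compact metric space and f : X → X a continuous map. For every x ∈ X, the set C(x) = {x} ∪ {y ∈ X : x → y} is chain stable: for every ε > 0 there is δ > 0 such that every δ-chain (x_i)_{i=0}^k of f with x_0 ∈ C(x) satisfies d(x_i, C(x)) ≤ ε for all 0 ≤ i ≤ k. -/
open Filter Topology Set

section Defs

variable {X : Type*} [MetricSpace X]

/-- `c 0, c 1, ..., c k` is a `δ`-chain of `f`. -/
def IsDeltaChain (f : X → X) (δ : ℝ) (c : ℕ → X) (k : ℕ) : Prop :=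
  ∀ i < k, dist (f (c i)) (c (i + 1)) ≤ δ

/-- `x → y` : for every `δ > 0` there is a `δ`-chain of `f` from `x` to `y`. -/
def ChainReach (f : X → X) (x y : X) : Prop :=
  ∀ δ > 0, ∃ (c : ℕ → X) (k : ℕ), 1 ≤ k ∧ IsDeltaChain f δ c k ∧ c 0 = x ∧ c k = y

/-- `C(x) = {x} ∪ {y : x → y}`. -/
def CSet (f : X → X) (x : X) : Set X := {x} ∪ {y | ChainReach f x y}

/-- The chain recurrent set. -/
def CR (f : X → X) : Set X := {x | ChainReach f x x}

/-- `C` is a chain component of `f` : an equivalence class of `↔` on `CR f`. -/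
def IsChainComponent (f : X → X) (C : Set X) : Prop :=
  ∃ x ∈ CR f, C = {y ∈ CR f | ChainReach f x y ∧ ChainReach f y x}

/-- A set `S` is chain stable for `f`. -/
def ChainStable (f : X → X) (S : Set X) : Prop :=
  ∀ ε > 0, ∃ δ > 0, ∀ (c : ℕ → X) (k : ℕ), 1 ≤ k → IsDeltaChain f δ c k → c 0 ∈ S →
    ∀ i ≤ k, Metric.infDist (c i) S ≤ ε

/-- `ξ` is a `δ`-pseudo orbit of `f`. -/
def IsPseudoOrbit (f : X → X) (δ : ℝ) (ξ : ℕ → X) : Prop :=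
  ∀ i, dist (f (ξ i)) (ξ (i + 1)) ≤ δ

/-- `x` is a shadowable point of `f`. -/
def ShadowablePt (f : X → X) (x : X) : Prop :=
  ∀ ε > 0, ∃ δ > 0, ∀ ξ : ℕ → X, IsPseudoOrbit f δ ξ → ξ 0 = x →
    ∃ y, ∀ i, dist (f^[i] y) (ξ i) ≤ ε

/-- `f` has the shadowing on `S`. -/
def ShadowingOn (f : X → X) (S : Set X) : Prop :=
  ∀ ε > 0, ∃ δ > 0, ∀ ξ : ℕ → X, IsPseudoOrbit f δ ξ → (∀ i, ξ i ∈ S) →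
    ∃ y, ∀ i, dist (f^[i] y) (ξ i) ≤ ε

/-- `f` has the shadowing property. -/
def ShadowingProperty (f : X → X) : Prop :=
  ∀ ε > 0, ∃ δ > 0, ∀ ξ : ℕ → X, IsPseudoOrbit f δ ξ →
    ∃ y, ∀ i, dist (f^[i] y) (ξ i) ≤ ε

/-- `f` is chain transitive. -/
def ChainTransitive (f : X → X) : Prop := ∀ x y : X, ChainReach f x y

/-- `f` restricted to `S` is chain continuous. -/
def ChainContinuousOn (f : X → X) (S : Set X) : Prop :=
  ∀ ε > 0, ∃ δ > 0, ∀ ξ η : ℕ → X, IsPseudoOrbit f δ ξ → IsPseudoOrbit f δ η →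
    (∀ i, ξ i ∈ S) → (∀ i, η i ∈ S) → ξ 0 = η 0 → ∀ i, dist (ξ i) (η i) ≤ ε

/-- `f` restricted to `S` is equicontinuous. -/
def EquicontinuousOnSet (f : X → X) (S : Set X) : Prop :=
  ∀ ε > 0, ∃ δ > 0, ∀ x ∈ S, ∀ y ∈ S, dist x y ≤ δ → ∀ i : ℕ, dist (f^[i] x) (f^[i] y) ≤ ε

/-- `s_n(f,K,r)` : largest cardinality of an `(n,r)`-separated subset of `K`. -/
noncomputable def sepNum (f : X → X) (K : Set X) (n : ℕ) (r : ℝ) : ℕ :=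
  sSup {m | ∃ E : Finset X, (E : Set X) ⊆ K ∧
    (∀ x ∈ E, ∀ y ∈ E, x ≠ y → ∃ i < n, r < dist (f^[i] x) (f^[i] y)) ∧ E.card = m}

/-- `h(f,K,r) = limsup (1/n) log s_n(f,K,r)`. -/
noncomputable def entH (f : X → X) (K : Set X) (r : ℝ) : EReal :=
  Filter.limsup (fun n : ℕ => ((Real.log (sepNum f K n r) / n : ℝ) : EReal)) Filter.atTop

/-- `h(f,K) = lim_{r → 0} h(f,K,r) = sup_{r > 0} h(f,K,r)`. -/
noncomputable def ent (f : X → X) (K : Set X) : EReal :=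
  ⨆ r ∈ Set.Ioi (0 : ℝ), entH f K r

/-- `Ent_r(f)`. -/
def EntR (f : X → X) (r : ℝ) : Set X :=
  {x | ∀ K : Set X, IsClosed K → K ∈ 𝓝 x → 0 < entH f K r}

/-- `Ent_{r,b}(f)`. -/
def EntRB (f : X → X) (r b : ℝ) : Set X :=
  {x | ∀ K : Set X, IsClosed K → K ∈ 𝓝 x → (b : EReal) ≤ entH f K r}

/-- The ω-limit set of `x` under `f`. -/
def omegaLim (f : X → X) (x : X) : Set X :=
  {y | ∃ φ : ℕ → ℕ, StrictMono φ ∧ Tendsto (fun j => f^[φ j] x) atTop (𝓝 y)}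

/-- The set of `e`-sensitive points of `f` restricted to `S`. -/
def SenE (f : X → X) (S : Set X) (e : ℝ) : Set X :=
  {x ∈ S | ∀ ε > 0, ∃ y ∈ S, dist x y ≤ ε ∧ ∃ i : ℕ, e < dist (f^[i] x) (f^[i] y)}

/-- `Sen(f|_S) = ⋃_{e > 0} Sen_e(f|_S)`. -/
def Sen (f : X → X) (S : Set X) : Set X := ⋃ e ∈ Set.Ioi (0 : ℝ), SenE f S e

/-- `(x,y)` is a scrambled pair for `f`. -/
def ScrambledPair (f : X → X) (x y : X) : Prop :=
  0 < Filter.limsup (fun i : ℕ => dist (f^[i] x) (f^[i] y)) Filter.atTop ∧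
    Filter.liminf (fun i : ℕ => dist (f^[i] x) (f^[i] y)) Filter.atTop = 0

/-- `M` is a minimal set for `f`. -/
def IsMinimalSet (f : X → X) (M : Set X) : Prop :=
  IsClosed M ∧ MapsTo f M M ∧ ∀ S ⊆ M, IsClosed S → MapsTo f S S → S = ∅ ∨ S = M

/-- `Φ_ε(x)`. -/
def Phi (f : X → X) (ε : ℝ) (x : X) : Set X :=
  {y | ∀ i : ℕ, dist (f^[i] x) (f^[i] y) ≤ ε}

/-- `h*_f(ε) = sup_x h(f,Φ_ε(x))`. -/
noncomputable def hStar (f : X → X) (ε : ℝ) : EReal := ⨆ x : X, ent f (Phi f ε x)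

/-- `f` is h-expansive. -/
def HExpansive (f : X → X) : Prop := ∃ ε > 0, hStar f ε = 0

end Defs

/-- Two `δ`-chains, the second starting where the first ends, can be concatenated. -/
theorem IsDeltaChain.append {X : Type*} [MetricSpace X] {f : X → X} {δ : ℝ} {a b : ℕ → X}
    {k l : ℕ} (ha : IsDeltaChain f δ a k) (hb : IsDeltaChain f δ b l) (hab : a k = b 0) :
    IsDeltaChain f δ (fun i => if i ≤ k then a i else b (i - k)) (k + l) := by
  intro i hi
  rcases lt_trichotomy i k with h | rfl | h
  · simpa [h.le, Nat.succ_le_of_lt h] using ha i h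
  · simpa [hab] using hb 0 (by omega)
  · simpa [show ¬ i ≤ k by omega, show ¬ i + 1 ≤ k by omega,
      show i + 1 - k = i - k + 1 by omega] using hb (i - k) (by omega)

/-- Moving the endpoint of a `δ`-chain by at most `η` gives a `(δ + η)`-chain. -/
theorem IsDeltaChain.update_last {X : Type*} [MetricSpace X] {f : X → X} {δ η : ℝ} {c : ℕ → X}
    {k : ℕ} (hc : IsDeltaChain f δ c k) {z : X} (hz : dist (c k) z ≤ η) :
    IsDeltaChain f (δ + η) (Function.update c k z) k := by
  intro i hi
  have h := hc i hi
  rw [Function.update_of_ne hi.ne]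
  rcases eq_or_ne (i + 1) k with rfl | hne
  · rw [Function.update_self]
    exact (dist_triangle _ (c (i + 1)) _).trans (add_le_add h hz)
  · rw [Function.update_of_ne hne]
    linarith [dist_nonneg.trans hz]

/-- A nontrivial `δ`-chain starting in `C(x)` can be replaced by one starting at `x`. -/
theorem IsDeltaChain.exists_from_of_mem_CSet {X : Type*} [MetricSpace X] {f : X → X} {δ : ℝ}
    (hδ : 0 < δ) {x : X} {c : ℕ → X} {k : ℕ} (hk : 1 ≤ k) (hc : IsDeltaChain f δ c k)
    (h0 : c 0 ∈ CSet f x) :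
    ∃ (b : ℕ → X) (l : ℕ), 1 ≤ l ∧ IsDeltaChain f δ b l ∧ b 0 = x ∧ b l = c k := by
  rcases h0 with h0 | h0
  · exact ⟨c, k, hk, hc, h0, rfl⟩
  · obtain ⟨a, l, hl, ha, ha0, hal⟩ := h0 δ hδ
    exact ⟨_, l + k, by omega, ha.append hc hal, by simpa using ha0,
      by simp [show ¬ k = 0 by omega]⟩

/-- Lemma 1.1: `C(x)` is chain stable for all `x ∈ X`. -/
theorem stmt_0 {X : Type*} [MetricSpace X] [CompactSpace X] (f : X → X)
    (hf : Continuous f) (x : X) : ChainStable f (CSet f x) := by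
  intro ε hε
  by_contra! H
  choose c k _ hc hc0 i hi hfar using fun n : ℕ =>
    H (1 / ((n : ℝ) + 1)) Nat.one_div_pos_of_nat
  obtain ⟨z, φ, hφ, hz⟩ := CompactSpace.tendsto_subseq fun n => c n (i n)
  have hzfar : ε ≤ Metric.infDist z (CSet f x) :=
    ge_of_tendsto' ((Metric.continuous_infDist_pt _).tendsto z |>.comp hz)
      fun n => (hfar (φ n)).le
  suffices hxz : z ∈ CSet f x by
    rw [Metric.infDist_zero_of_mem hxz] at hzfar
    linarith
  refine Or.inr fun δ hδ => ?_
  have hsmall : ∀ᶠ n in atTop, 1 / ((φ n : ℝ) + 1) < δ / 2 :=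
    (tendsto_one_div_add_atTop_nhds_zero_nat.comp hφ.tendsto_atTop).eventually_lt_const
      (half_pos hδ)
  obtain ⟨n, hn, hnz⟩ := (hsmall.and (hz.eventually (Metric.ball_mem_nhds z (half_pos hδ)))).exists
  have hpos : 1 ≤ i (φ n) := by
    by_contra! h
    have hlt := hfar (φ n)
    rw [Nat.lt_one_iff.mp h, Metric.infDist_zero_of_mem (hc0 _)] at hlt
    linarith
  have hchain : IsDeltaChain f (δ / 2) (c (φ n)) (i (φ n)) := fun j hj =>
    (hc (φ n) j (hj.trans_le (hi _))).trans hn.le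
  obtain ⟨b, l, hl, hb, hb0, hbl⟩ :=
    hchain.exists_from_of_mem_CSet (half_pos hδ) hpos (hc0 _)
  refine ⟨Function.update b l z, l, hl, ?_, ?_, Function.update_self ..⟩
  · rw [← add_halves δ]
    exact hb.update_last (hbl ▸ (Metric.mem_ball.mp hnz).le)
  · rwa [Function.update_of_ne (by omega)]
end

section
/- Let (X,d) be a compact metric space, f : X → X a continuous map, and x ∈ X. The following are equivalent: (1) x ∈ Sh(f); (2) C(x) ⊆ Sh(f); (3) f has the shadowing on C(x). -/
open Filter Topology Set

/-- The `δ` witnessing that `x` is shadowable works uniformly for all points of `C(x)`: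
a pseudo orbit starting in `C(x)` can be prefixed by a chain from `x`. -/
theorem ShadowablePt.exists_uniform_on_CSet {X : Type*} [MetricSpace X] {f : X → X} {x : X}
    (h : ShadowablePt f x) :
    ∀ ε > 0, ∃ δ > 0, ∀ ξ : ℕ → X, IsPseudoOrbit f δ ξ → ξ 0 ∈ CSet f x →
      ∃ y, ∀ i, dist (f^[i] y) (ξ i) ≤ ε := by
  intro ε hε
  obtain ⟨δ, hδ, H⟩ := h ε hε
  refine ⟨δ, hδ, fun ξ hξ h0 => ?_⟩
  rcases h0 with h0 | h0
  · exact H ξ hξ h0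
  obtain ⟨c, k, hk, hc, hc0, hck⟩ := h0 δ hδ
  obtain ⟨z, hz⟩ := H (fun i => if i < k then c i else ξ (i - k)) (by
    intro i
    rcases lt_trichotomy (i + 1) k with h1 | h1 | h1
    · simpa [h1, show i < k by omega] using hc i (by omega)
    · simpa [← h1, ← hck] using hc i (by omega)
    · have := hξ (i - k)
      rw [show i - k + 1 = i + 1 - k by omega] at this
      simpa [show ¬ i < k by omega, show ¬ i + 1 < k by omega] using this)
    (by simpa [show 0 < k by omega] using hc0)
  refine ⟨f^[k] z, fun i => ?_⟩
  simpa [← Function.iterate_add_apply] using hz (i + k)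

/-- Endpoints of sufficiently fine chains starting at `x` are close to `C(x)`. -/
theorem exists_deltaChain_end_near_CSet {X : Type*} [MetricSpace X] [CompactSpace X]
    (f : X → X) (x : X) {η : ℝ} (hη : 0 < η) :
    ∃ δ > 0, ∀ (c : ℕ → X) (k : ℕ), 1 ≤ k → IsDeltaChain f δ c k → c 0 = x →
      ∃ y ∈ CSet f x, dist (c k) y ≤ η := by
  by_contra! H
  choose c k hk hc hc0 hfar using fun n : ℕ => H (1 / ((n : ℝ) + 1)) (by positivity)
  obtain ⟨y, φ, hφ, hy⟩ := CompactSpace.tendsto_subseq (fun n => c n (k n))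
  have hyC : y ∈ CSet f x := by
    refine Or.inr fun δ hδ => ?_
    have hsmall := (tendsto_one_div_add_atTop_nhds_zero_nat (𝕜 := ℝ)).comp hφ.tendsto_atTop
    obtain ⟨n, hn, hn'⟩ := ((hsmall.eventually (gt_mem_nhds (half_pos hδ))).and
      (Metric.tendsto_nhds.1 hy _ (half_pos hδ))).exists
    simp only [Function.comp_apply] at hn hn'
    have hkn := hk (φ n)
    refine ⟨Function.update (c (φ n)) (k (φ n)) y, k (φ n), hkn, fun i hi => ?_, ?_, by simp⟩
    · have hci := hc (φ n) i hi
      rw [Function.update_of_ne hi.ne]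
      rcases eq_or_ne (i + 1) (k (φ n)) with he | he
      · rw [he] at hci ⊢
        rw [Function.update_self]
        linarith [dist_triangle (f (c (φ n) i)) (c (φ n) (k (φ n))) y]
      · rw [Function.update_of_ne he]
        linarith
    · rw [Function.update_of_ne (by omega), hc0]
  obtain ⟨n, hn⟩ := (Metric.tendsto_nhds.1 hy η hη).exists
  exact (hfar (φ n) y hyC).not_gt hn

/-- Shadowing on `C(x)` makes `x` shadowable: fine pseudo orbits from `x` stay near `C(x)`, hence
are close to pseudo orbits in `C(x)`. -/
theorem ShadowingOn.shadowablePt {X : Type*} [MetricSpace X] [CompactSpace X] {f : X → X}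
    (hf : Continuous f) {x : X} (h : ShadowingOn f (CSet f x)) : ShadowablePt f x := by
  intro ε hε
  obtain ⟨δ₀, hδ₀, H⟩ := h (ε / 2) (half_pos hε)
  obtain ⟨ρ, hρ, hfρ⟩ := Metric.uniformContinuous_iff.1
    (CompactSpace.uniformContinuous_of_continuous hf) (δ₀ / 3) (by positivity)
  obtain ⟨η, hη, hηm⟩ := exists_between (show 0 < min ρ (min (ε / 2) (δ₀ / 3)) by positivity)
  simp only [lt_min_iff] at hηm
  obtain ⟨δ, hδ, hnear⟩ := exists_deltaChain_end_near_CSet f x hη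
  refine ⟨min δ (δ₀ / 3), by positivity, fun ξ hξ h0 => ?_⟩
  have hclose : ∀ i, ∃ y ∈ CSet f x, dist (ξ i) y ≤ η := by
    intro i
    rcases Nat.eq_zero_or_pos i with rfl | hi
    · exact ⟨x, Or.inl rfl, by simpa [h0] using hη.le⟩
    · exact hnear ξ i hi (fun j _ => (hξ j).trans (min_le_left _ _)) h0
  choose ζ hζC hζ using hclose
  obtain ⟨y, hy⟩ := H ζ (fun i => by
    have h1 : dist (f (ξ i)) (f (ζ i)) < δ₀ / 3 := hfρ ((hζ i).trans_lt hηm.1)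
    have h2 := (hξ i).trans (min_le_right _ _)
    have h3 := hζ (i + 1)
    rw [dist_comm] at h1
    linarith [dist_triangle4 (f (ζ i)) (f (ξ i)) (ξ (i + 1)) (ζ (i + 1))]) hζC
  refine ⟨y, fun i => ?_⟩
  have h1 := hζ i
  rw [dist_comm] at h1
  linarith [dist_triangle (f^[i] y) (ζ i) (ξ i), hy i]

/-- Lemma 1.2: `x ∈ Sh(f)` iff `C(x) ⊆ Sh(f)` iff `f` has the shadowing on `C(x)`. -/
theorem stmt_1 {X : Type*} [MetricSpace X] [CompactSpace X] (f : X → X)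
    (hf : Continuous f) (x : X) :
    List.TFAE [ShadowablePt f x,
      CSet f x ⊆ {y | ShadowablePt f y},
      ShadowingOn f (CSet f x)] := by
  tfae_have 1 → 2 := fun h y hy ε hε => by
    obtain ⟨δ, hδ, H⟩ := h.exists_uniform_on_CSet ε hε
    exact ⟨δ, hδ, fun ξ hξ h0 => H ξ hξ (h0 ▸ hy)⟩
  tfae_have 2 → 1 := fun h => h (Or.inl rfl)
  tfae_have 1 → 3 := fun h ε hε => by
    obtain ⟨δ, hδ, H⟩ := h.exists_uniform_on_CSet ε hε
    exact ⟨δ, hδ, fun ξ hξ hC => H ξ hξ (hC 0)⟩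
  tfae_have 3 → 1 := fun h => h.shadowablePt hf
  tfae_finish
end

section
/- Let (X,d) be a compact metric space, f : X → X a continuous map, and x ∈ Sh(f). Then x ∈ ⋃_{r>0} Ent_r(f) if and only if there exists a chain component C of f with C ⊆ C(x) such that f|_C : C → C is not chain continuous. -/
open Filter Topology Set

section ChainLemmas

variable {X : Type*} {f : X → X}

/-- Concatenation of `c 0, ..., c k` with `d 0, d 1, ...`, where `c k` is dropped. -/
def concatChain (c : ℕ → X) (k : ℕ) (d : ℕ → X) : ℕ → X :=
  fun i => if i < k then c i else d (i - k)

lemma concatChain_of_lt {c d : ℕ → X} {k i : ℕ} (h : i < k) : concatChain c k d i = c i :=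
  if_pos h

lemma concatChain_add (c d : ℕ → X) (k i : ℕ) : concatChain c k d (k + i) = d i := by
  simp [concatChain]

lemma concatChain_of_le {c d : ℕ → X} {k i : ℕ} (h : c k = d 0) (hi : i ≤ k) :
    concatChain c k d i = c i := by
  rcases hi.lt_or_eq with hi | rfl
  · exact concatChain_of_lt hi
  · rw [h]; exact concatChain_add c d i 0

variable [MetricSpace X]

lemma IsDeltaChain.concat {δ : ℝ} {c d : ℕ → X} {k l : ℕ} (hc : IsDeltaChain f δ c k)
    (hd : IsDeltaChain f δ d l) (h : c k = d 0) :
    IsDeltaChain f δ (concatChain c k d) (k + l) := by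
  intro i hi
  rcases lt_or_ge i k with hik | hik
  · rw [concatChain_of_lt hik, concatChain_of_le h hik]
    exact hc i hik
  · obtain ⟨j, rfl⟩ := Nat.exists_eq_add_of_le hik
    rw [concatChain_add, add_assoc, concatChain_add]
    exact hd j (by omega)

lemma ChainReach.trans {a b c : X} (hab : ChainReach f a b) (hbc : ChainReach f b c) :
    ChainReach f a c := by
  intro δ hδ
  obtain ⟨u, k, hk, hu, rfl, rfl⟩ := hab δ hδ
  obtain ⟨v, l, hl, hv, hv0, rfl⟩ := hbc δ hδ
  exact ⟨concatChain u k v, k + l, by omega, hu.concat hv hv0.symm,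
    concatChain_of_lt hk, concatChain_add u v k l⟩

lemma chainReach_apply (a : X) : ChainReach f a (f a) := by
  intro δ hδ
  refine ⟨fun i => f^[i] a, 1, le_rfl, fun i _ => ?_, rfl, rfl⟩
  simp only [Function.iterate_succ_apply', dist_self]
  exact hδ.le

/-- Orbit segments from near `a` to near `b` yield chains from `a` to `b`. -/
lemma chainReach_of_orbit (hf : Continuous f) {a b : X}
    (h : ∀ ε > 0, ∃ y k, 1 ≤ k ∧ dist y a < ε ∧ dist (f^[k] y) b < ε) : ChainReach f a b := by
  intro δ hδ
  obtain ⟨ρ, hρ, hfa⟩ := Metric.continuous_iff.1 hf a (δ / 2) (half_pos hδ)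
  obtain ⟨y, k, hk, hya, hyb⟩ := h (min ρ (δ / 2)) (lt_min hρ (half_pos hδ))
  have h1 : dist (f a) (f y) < δ / 2 := by
    rw [dist_comm]; exact hfa y (hya.trans_le (min_le_left _ _))
  have h2 : dist (f^[k] y) b < δ / 2 := hyb.trans_le (min_le_right _ _)
  refine ⟨fun i => if i = 0 then a else if i = k then b else f^[i] y, k, hk, ?_, by simp, ?_⟩
  · intro i hi
    have hstart : dist (f (if i = 0 then a else if i = k then b else f^[i] y)) (f^[i + 1] y)
        ≤ δ / 2 := by
      rw [Function.iterate_succ_apply']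
      by_cases hi0 : i = 0
      · simpa [hi0] using h1.le
      · simpa [hi0, hi.ne] using (half_pos hδ).le
    have hend : dist (f^[i + 1] y) (if i + 1 = k then b else f^[i + 1] y) ≤ δ / 2 := by
      split_ifs with hik
      · rw [hik]; exact h2.le
      · simpa using (half_pos hδ).le
    simp only [Nat.add_eq_zero_iff, one_ne_zero, and_false, if_false]
    linarith [dist_triangle (f (if i = 0 then a else if i = k then b else f^[i] y))
      (f^[i + 1] y) (if i + 1 = k then b else f^[i + 1] y)]
  · simp [show k ≠ 0 by omega]

lemma isClosed_setOf_chainReach (a : X) : IsClosed {y | ChainReach f a y} := by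
  refine isClosed_of_closure_subset fun w hw δ hδ => ?_
  obtain ⟨v, hv, hvw⟩ := Metric.mem_closure_iff.1 hw (δ / 2) (half_pos hδ)
  obtain ⟨c, k, hk, hc, hc0, rfl⟩ := hv (δ / 2) (half_pos hδ)
  refine ⟨fun i => if i = k then w else c i, k, hk, fun i hi => ?_, ?_, by simp⟩
  · have h := hc i hi
    simp only [hi.ne, if_false]
    split_ifs with hik
    · rw [hik] at h
      linarith [dist_triangle (f (c i)) (c k) w, dist_comm w (c k)]
    · linarith
  · simp [show 0 ≠ k by omega, hc0]

lemma isClosed_cSet (a : X) : IsClosed (CSet f a) :=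
  isClosed_singleton.union (isClosed_setOf_chainReach a)

lemma chainReach_apply_self (hf : Continuous f) {a : X} (ha : a ∈ CR f) :
    ChainReach f (f a) a := by
  intro δ hδ
  obtain ⟨ρ, hρ, hfa⟩ := Metric.continuous_iff.1 hf (f a) (δ / 2) (half_pos hδ)
  set δ' := min (ρ / 2) (δ / 2)
  have hδ'pos : 0 < δ' := lt_min (half_pos hρ) (half_pos hδ)
  obtain ⟨c, k, hk, hc, hc0, hck⟩ : ∃ (c : ℕ → X) (k : ℕ), 2 ≤ k ∧ IsDeltaChain f δ' c k ∧
      c 0 = a ∧ c k = a := by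
    obtain ⟨c, k, hk, hc, hc0, hck⟩ := ha δ' hδ'pos
    exact ⟨concatChain c k c, k + k, by omega, hc.concat hc (hck.trans hc0.symm),
      (concatChain_of_lt hk).trans hc0, (concatChain_add c c k k).trans hck⟩
  refine ⟨fun i => if i = 0 then f a else c (i + 1), k - 1, by omega, fun i hi => ?_, by simp, ?_⟩
  · have h := (hc (i + 1) (by omega)).trans (min_le_right _ _)
    by_cases hi0 : i = 0
    · subst hi0
      have h0 := (hc 0 (by omega)).trans (min_le_left _ _)
      rw [hc0] at h0
      have h1 : dist (f (c 1)) (f (f a)) < δ / 2 := hfa _ (by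
        rw [dist_comm]; simp only [zero_add] at h0; linarith)
      simp only [if_true, zero_add, one_ne_zero, if_false] at h ⊢
      linarith [dist_triangle (f (f a)) (f (c 1)) (c (1 + 1)), dist_comm (f (f a)) (f (c 1))]
    · simp only [hi0, if_false, Nat.add_eq_zero_iff, one_ne_zero, and_false]
      linarith
  · simp [show k - 1 ≠ 0 by omega, Nat.sub_add_cancel (show 1 ≤ k by omega), hck]

/-- The chain component of a chain recurrent point `z`. -/
def chainClass (f : X → X) (z : X) : Set X :=
  {y ∈ CR f | ChainReach f z y ∧ ChainReach f y z}

lemma mapsTo_chainClass (hf : Continuous f) (z : X) :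
    MapsTo f (chainClass f z) (chainClass f z) := by
  rintro w ⟨hw, hzw, hwz⟩
  have h := chainReach_apply_self hf hw
  exact ⟨h.trans (chainReach_apply w), hzw.trans (chainReach_apply w), h.trans hwz⟩

lemma chainClass_subset_cSet {a z : X} (hz : z ∈ CSet f a) : chainClass f z ⊆ CSet f a := by
  rintro y ⟨-, hzy, -⟩
  rcases hz with rfl | hz
  · exact Or.inr hzy
  · exact Or.inr (ChainReach.trans hz hzy)

/-- Orbit segments that start and end close to `z` stay close to the chain component of `z`. -/
lemma orbit_near_chainClass [CompactSpace X] (hf : Continuous f) {z : X} (hz : z ∈ CR f)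
    {η : ℝ} (hη : 0 < η) :
    ∃ ρ > 0, ∀ y j, dist y z < ρ → dist (f^[j] y) z < ρ →
      ∀ l ≤ j, ∃ w ∈ chainClass f z, dist (f^[l] y) w < η := by
  by_contra! hcon
  have hzC : z ∈ chainClass f z := ⟨hz, hz, hz⟩
  choose y j hy hj l hl hfar using fun n : ℕ =>
    hcon (min η (1 / ((n : ℝ) + 1))) (lt_min hη Nat.one_div_pos_of_nat)
  have hl0 : ∀ n, 1 ≤ l n := by
    intro n
    by_contra! h0
    have := hfar n z hzC
    rw [Nat.lt_one_iff.1 h0] at this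
    exact absurd ((hy n).trans_le (min_le_left _ _)) (not_lt.2 this)
  have hlj : ∀ n, 1 ≤ j n - l n := by
    intro n
    by_contra! h0
    have := hfar n z hzC
    rw [show l n = j n by have := hl n; omega] at this
    exact absurd ((hj n).trans_le (min_le_left _ _)) (not_lt.2 this)
  obtain ⟨w, φ, hφ, hw⟩ := CompactSpace.tendsto_subseq fun n => f^[l n] (y n)
  have hev : ∀ ε > 0, ∃ n, dist (y n) z < ε ∧ dist (f^[j n] (y n)) z < ε ∧
      dist (f^[l n] (y n)) w < ε := by
    intro ε hε
    have h1 := (tendsto_one_div_add_atTop_nhds_zero_nat.comp hφ.tendsto_atTop).eventually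
      (gt_mem_nhds hε)
    obtain ⟨n, hn1, hn2⟩ := (h1.and (Metric.tendsto_nhds.1 hw ε hε)).exists
    exact ⟨φ n, ((hy _).trans_le (min_le_right _ _)).trans hn1,
      ((hj _).trans_le (min_le_right _ _)).trans hn1, hn2⟩
  have hzw : ChainReach f z w := chainReach_of_orbit hf fun ε hε => by
    obtain ⟨n, h1, -, h3⟩ := hev ε hε
    exact ⟨y n, l n, hl0 n, h1, h3⟩
  have hwz : ChainReach f w z := chainReach_of_orbit hf fun ε hε => by
    obtain ⟨n, -, h2, h3⟩ := hev ε hε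
    refine ⟨f^[l n] (y n), j n - l n, hlj n, h3, ?_⟩
    rwa [← Function.iterate_add_apply, Nat.sub_add_cancel (hl n)]
  obtain ⟨n, -, -, h3⟩ := hev η hη
  exact absurd h3 (not_lt.2 (hfar n w ⟨hwz.trans hzw, hzw, hwz⟩))

/-- Orbit segments close to an invariant set are traced by pseudo orbits of that set. -/
lemma exists_pseudoOrbit_near {S : Set X} (hS : MapsTo f S S) {δ η : ℝ} (hηδ : η ≤ δ / 2)
    (hcont : ∀ a b, dist a b < η → dist (f a) (f b) < δ / 2) {y z : X} {j : ℕ} (hz : z ∈ S)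
    (hyz : dist y z < η) (hnear : ∀ l ≤ j, ∃ w ∈ S, dist (f^[l] y) w < η) :
    ∃ ξ : ℕ → X, IsPseudoOrbit f δ ξ ∧ (∀ i, ξ i ∈ S) ∧ ξ 0 = z ∧
      ∀ l ≤ j, dist (f^[l] y) (ξ l) < η := by
  obtain ⟨w, hw0, hw⟩ : ∃ w : ℕ → X, w 0 = z ∧
      ∀ l ≤ j, w l ∈ S ∧ dist (f^[l] y) (w l) < η := by
    have : Nonempty X := ⟨z⟩
    choose! w hwS hwd using hnear
    refine ⟨Function.update w 0 z, by simp, fun l hl => ?_⟩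
    by_cases h : l = 0
    · subst h; simpa using ⟨hz, hyz⟩
    · simpa [h] using ⟨hwS l hl, hwd l hl⟩
  have hη : 0 < η := dist_nonneg.trans_lt hyz
  have hglue : w j = (fun i => f^[i] (w j)) 0 := rfl
  refine ⟨concatChain w j fun i => f^[i] (w j), fun i => ?_, fun i => ?_, ?_, fun l hl => ?_⟩
  · rcases lt_or_ge i j with hi | hi
    · rw [concatChain_of_lt hi, concatChain_of_le hglue hi]
      have h1 := hcont _ _ (hw i hi.le).2
      have h2 := (hw (i + 1) hi).2
      rw [← Function.iterate_succ_apply' f] at h1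
      linarith [dist_triangle_left (f (w i)) (w (i + 1)) (f^[i + 1] y)]
    · obtain ⟨k, rfl⟩ := Nat.exists_eq_add_of_le hi
      rw [concatChain_add, add_assoc, concatChain_add, Function.iterate_succ_apply', dist_self]
      linarith
  · rcases lt_or_ge i j with hi | hi
    · rw [concatChain_of_lt hi]
      exact (hw i hi.le).1
    · obtain ⟨k, rfl⟩ := Nat.exists_eq_add_of_le hi
      rw [concatChain_add]
      exact hS.iterate k (hw j le_rfl).1
  · rw [concatChain_of_le hglue (Nat.zero_le j), hw0]
  · rw [concatChain_of_le hglue hl]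
    exact (hw l hl).2

/-- If the chain component of `z` is chain continuous, then any two orbit segments which both start
and end in a small neighborhood of `z` stay close to each other. -/
lemma exists_ball_orbits_close [CompactSpace X] (hf : Continuous f) {z : X}
    (hz : z ∈ CR f → ChainContinuousOn f (chainClass f z)) {r : ℝ} (hr : 0 < r) :
    ∃ ρ > 0, ∀ y ∈ Metric.ball z ρ, ∀ y' ∈ Metric.ball z ρ, ∀ j,
      f^[j] y ∈ Metric.ball z ρ → f^[j] y' ∈ Metric.ball z ρ →
      ∀ l ≤ j, dist (f^[l] y) (f^[l] y') ≤ r := by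
  simp only [Metric.mem_ball]
  by_cases hzr : z ∈ CR f
  · obtain ⟨δ, hδ, hcc⟩ := hz hzr (r / 3) (by positivity)
    obtain ⟨η₀, hη₀, hcont⟩ := Metric.uniformContinuous_iff.1
      (CompactSpace.uniformContinuous_of_continuous hf) (δ / 2) (half_pos hδ)
    set η := min η₀ (min (δ / 2) (r / 3))
    have hη : 0 < η := by positivity
    have hηδ : η ≤ δ / 2 := (min_le_right _ _).trans (min_le_left _ _)
    have hηr : η ≤ r / 3 := (min_le_right _ _).trans (min_le_right _ _)
    have hcont' : ∀ a b, dist a b < η → dist (f a) (f b) < δ / 2 :=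
      fun a b h => hcont (h.trans_le (min_le_left _ _))
    obtain ⟨ρ, hρ, hnear⟩ := orbit_near_chainClass hf hzr hη
    have hzC : z ∈ chainClass f z := ⟨hzr, hzr, hzr⟩
    have hinv := mapsTo_chainClass hf z
    refine ⟨min ρ η, lt_min hρ hη, fun y hy y' hy' j hj hj' l hl => ?_⟩
    rw [lt_min_iff] at hy hy' hj hj'
    obtain ⟨ξ, hξ, hξC, hξ0, hξy⟩ :=
      exists_pseudoOrbit_near hinv hηδ hcont' hzC hy.2 (hnear y j hy.1 hj.1)
    obtain ⟨ξ', hξ', hξC', hξ0', hξy'⟩ :=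
      exists_pseudoOrbit_near hinv hηδ hcont' hzC hy'.2 (hnear y' j hy'.1 hj'.1)
    have h := hcc ξ ξ' hξ hξ' hξC hξC' (hξ0.trans hξ0'.symm) l
    linarith [dist_triangle4_right (f^[l] y) (f^[l] y') (ξ l) (ξ' l), hξy l hl, hξy' l hl]
  · have : ∃ ε > 0, ∀ y k, 1 ≤ k → dist y z < ε → ¬ dist (f^[k] y) z < ε := by
      by_contra! hcon
      exact hzr (chainReach_of_orbit hf hcon)
    obtain ⟨ε, hε, hno⟩ := this
    refine ⟨min ε (r / 2), lt_min hε (half_pos hr), fun y hy y' hy' j hj _ l hl => ?_⟩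
    rw [lt_min_iff] at hy hy' hj
    have hj0 : j = 0 := by
      by_contra h0
      exact hno y j (by omega) hy.1 hj.1
    obtain rfl : l = 0 := by omega
    simp only [Function.iterate_zero, id]
    have htri := dist_triangle_right y y' z
    linarith

/-- Orbits starting near `x` remain in any prescribed neighborhood of `C(x)`. -/
lemma exists_closedBall_orbit_mem [CompactSpace X] (hf : Continuous f) {x : X} {U : Set X}
    (hU : IsOpen U) (hxU : CSet f x ⊆ U) :
    ∃ ρ > 0, ∀ y ∈ Metric.closedBall x ρ, ∀ n, f^[n] y ∈ U := by
  obtain ⟨ρ₀, hρ₀, hball⟩ := Metric.isOpen_iff.1 hU x (hxU (Or.inl rfl))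
  by_contra! hcon
  choose y hy n hn using fun k : ℕ =>
    hcon (min (ρ₀ / 2) (1 / ((k : ℝ) + 1))) (lt_min (half_pos hρ₀) Nat.one_div_pos_of_nat)
  have hn0 : ∀ k, 1 ≤ n k := by
    intro k
    by_contra! h0
    refine hn k ?_
    rw [Nat.lt_one_iff.1 h0]
    exact hball (lt_of_le_of_lt ((hy k).trans (min_le_left _ _)) (half_lt_self hρ₀))
  obtain ⟨w, φ, hφ, hw⟩ := CompactSpace.tendsto_subseq fun k => f^[n k] (y k)
  have hwU : w ∉ U :=
    hU.isClosed_compl.mem_of_tendsto hw (Eventually.of_forall fun k => hn (φ k))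
  refine hwU (hxU (Or.inr (chainReach_of_orbit hf fun ε hε => ?_)))
  have h1 := (tendsto_one_div_add_atTop_nhds_zero_nat.comp hφ.tendsto_atTop).eventually
    (gt_mem_nhds hε)
  obtain ⟨k, hk1, hk2⟩ := (h1.and (Metric.tendsto_nhds.1 hw ε hε)).exists
  exact ⟨y (φ k), n (φ k), hn0 _, lt_of_le_of_lt ((hy _).trans (min_le_right _ _)) hk1, hk2⟩

end ChainLemmas

section EntropyLemmas

variable {X : Type*} [MetricSpace X] {f : X → X}

/-- A polynomial bound on separated sets: if all orbits from `K` stay in `⋃ i, V i` and each `V i`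
synchronizes orbit segments starting and ending in it, then `s_n(f,K,r) ≤ (n² + 1)^m`. -/
lemma sepNum_le_of_cover {ι : Type*} [Fintype ι] {K : Set X} {r : ℝ} {V : ι → Set X}
    (hV : ∀ i, ∀ y ∈ V i, ∀ y' ∈ V i, ∀ j, f^[j] y ∈ V i → f^[j] y' ∈ V i →
      ∀ l ≤ j, dist (f^[l] y) (f^[l] y') ≤ r)
    (hK : ∀ y ∈ K, ∀ n, ∃ i, f^[n] y ∈ V i) (n : ℕ) :
    sepNum f K n r ≤ (n * n + 1) ^ Fintype.card ι := by
  classical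
  have hcode : ∀ (y : X) (i : ι), ∃ c : Option (Fin n × Fin n),
      (∀ l < n, f^[l] y ∈ V i → ∃ a b, c = some (a, b) ∧ a.1 ≤ l ∧ l ≤ b.1) ∧
      ∀ a b, c = some (a, b) → f^[a.1] y ∈ V i ∧ f^[b.1] y ∈ V i := by
    intro y i
    set T : Finset (Fin n) := Finset.univ.filter fun l => f^[l.1] y ∈ V i with hT
    by_cases hne : T.Nonempty
    · refine ⟨some (T.min' hne, T.max' hne), fun l hl hly => ?_, fun a b hab => ?_⟩
      · have hlT : (⟨l, hl⟩ : Fin n) ∈ T := by simpa [hT] using hly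
        exact ⟨_, _, rfl, T.min'_le _ hlT, T.le_max' _ hlT⟩
      · obtain ⟨rfl, rfl⟩ := Prod.mk.inj (Option.some.inj hab)
        exact ⟨(Finset.mem_filter.1 (T.min'_mem hne)).2, (Finset.mem_filter.1 (T.max'_mem hne)).2⟩
    · refine ⟨none, fun l hl hly => ?_, by simp⟩
      exact absurd ⟨⟨l, hl⟩, by simpa [hT] using hly⟩ hne
  choose code hcode₁ hcode₂ using hcode
  refine csSup_le' ?_
  rintro _ ⟨E, hEK, hE, rfl⟩
  have hinj : Set.InjOn code E := by
    intro y hy y' hy' hyy'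
    by_contra hne
    obtain ⟨l, hl, hlr⟩ := hE y hy y' hy' hne
    obtain ⟨i, hi⟩ := hK y (hEK hy) l
    obtain ⟨a, b, hab, hal, hlb⟩ := hcode₁ y i l hl hi
    obtain ⟨hya, hyb⟩ := hcode₂ y i a b hab
    obtain ⟨hya', hyb'⟩ := hcode₂ y' i a b (by rw [← hyy', hab])
    have h := hV i _ hya _ hya' (b - a)
      (by rwa [← Function.iterate_add_apply, Nat.sub_add_cancel (hal.trans hlb)])
      (by rwa [← Function.iterate_add_apply, Nat.sub_add_cancel (hal.trans hlb)]) (l - a) (by omega)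
    rw [← Function.iterate_add_apply, ← Function.iterate_add_apply, Nat.sub_add_cancel hal] at h
    exact absurd hlr (not_lt.2 h)
  calc E.card = (E.image code).card := (Finset.card_image_of_injOn hinj).symm
    _ ≤ Fintype.card (ι → Option (Fin n × Fin n)) := Finset.card_le_univ _
    _ = (n * n + 1) ^ Fintype.card ι := by simp

lemma entH_le_zero_of_sepNum_le {K : Set X} {r : ℝ} (m : ℕ)
    (h : ∀ n, sepNum f K n r ≤ (n * n + 1) ^ m) : entH f K r ≤ 0 := by
  have hlim : Tendsto (fun n : ℕ => (3 * m * (Real.log n / n) : ℝ)) atTop (𝓝 0) := by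
    have h0 := Real.isLittleO_log_id_atTop.tendsto_div_nhds_zero.comp
      (tendsto_natCast_atTop_atTop (R := ℝ))
    simpa using h0.const_mul (3 * (m : ℝ))
  have hlim' : Tendsto (fun n : ℕ => ((3 * m * (Real.log n / n) : ℝ) : EReal)) atTop (𝓝 0) :=
    (continuous_coe_real_ereal.tendsto 0).comp hlim
  rw [← hlim'.limsup_eq]
  refine limsup_le_limsup ?_
  filter_upwards [eventually_ge_atTop 2] with n hn
  have hn' : (2 : ℝ) ≤ n := by exact_mod_cast hn
  have hpow : (sepNum f K n r : ℝ) ≤ (n : ℝ) ^ (3 * m) := by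
    have h3 : n * n + 1 ≤ n ^ 3 := by nlinarith [Nat.mul_le_mul hn (Nat.mul_le_mul hn hn)]
    rw [pow_mul]
    exact_mod_cast (h n).trans (Nat.pow_le_pow_left h3 m)
  have hlog : Real.log (sepNum f K n r) ≤ 3 * m * Real.log n := by
    rcases Nat.eq_zero_or_pos (sepNum f K n r) with h0 | h0
    · rw [h0, Nat.cast_zero, Real.log_zero]
      have := Real.log_nonneg (by linarith : (1 : ℝ) ≤ n)
      positivity
    · have := Real.log_le_log (by exact_mod_cast h0) hpow
      rw [Real.log_pow] at this
      exact_mod_cast this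
  rw [EReal.coe_le_coe_iff, ← mul_div_assoc]
  gcongr

lemma bddAbove_card_separated [CompactSpace X] (hf : Continuous f) (K : Set X) (n : ℕ) {r : ℝ}
    (hr : 0 < r) :
    BddAbove {m | ∃ E : Finset X, (E : Set X) ⊆ K ∧
      (∀ x ∈ E, ∀ y ∈ E, x ≠ y → ∃ i < n, r < dist (f^[i] x) (f^[i] y)) ∧ E.card = m} := by
  have hopen : ∀ z : X, IsOpen {y | ∀ i ∈ Finset.range n, dist (f^[i] y) (f^[i] z) < r / 2} := by
    intro z
    simp only [Set.ofPred_forall]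
    exact isOpen_biInter_finset fun i _ =>
      isOpen_lt ((hf.iterate i).dist continuous_const) continuous_const
  obtain ⟨t, ht⟩ := isCompact_univ.elim_finite_subcover _ hopen fun z _ =>
    Set.mem_iUnion.2 ⟨z, fun i _ => by rw [dist_self]; exact half_pos hr⟩
  have hc : ∀ y : X, ∃ z ∈ t, ∀ i ∈ Finset.range n, dist (f^[i] y) (f^[i] z) < r / 2 := by
    intro y
    simpa using ht (Set.mem_univ y)
  choose c hct hc using hc
  refine ⟨t.card, ?_⟩
  rintro _ ⟨E, -, hE, rfl⟩
  refine Finset.card_le_card_of_injOn c (fun y _ => hct y) fun y hy y' hy' hyy' => ?_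
  by_contra hne
  obtain ⟨i, hi, hri⟩ := hE y hy y' hy' hne
  have h1 := hc y i (Finset.mem_range.2 hi)
  have h2 := hc y' i (Finset.mem_range.2 hi)
  rw [← hyy'] at h2
  linarith [dist_triangle_right (f^[i] y) (f^[i] y') (f^[i] (c y))]

lemma entH_pos_of_sepNum_ge {K : Set X} {r : ℝ} {L m : ℕ} (hm : 1 ≤ m)
    (h : ∀ N, 2 ^ N ≤ sepNum f K (L + N * m) r) : 0 < entH f K r := by
  have hLm : (0 : ℝ) < L + m := by
    have : (1 : ℝ) ≤ m := by exact_mod_cast hm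
    positivity
  have hpos : (0 : EReal) < ((Real.log 2 / (L + m) : ℝ) : EReal) := by
    exact_mod_cast div_pos (Real.log_pos one_lt_two) hLm
  refine hpos.trans_le (le_limsup_of_frequently_le ?_)
  refine frequently_atTop.2 fun a => ⟨L + (a + 1) * m, by nlinarith, ?_⟩
  rw [EReal.coe_le_coe_iff]
  have h1 : ((a + 1 : ℕ) : ℝ) * Real.log 2 ≤ Real.log (sepNum f K (L + (a + 1) * m) r) := by
    rw [← Real.log_pow]
    exact Real.log_le_log (by positivity) (by exact_mod_cast h (a + 1))
  have h2 : (0 : ℝ) < ((L + (a + 1) * m : ℕ) : ℝ) := by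
    have : 0 < L + (a + 1) * m := by positivity
    exact_mod_cast this
  rw [div_le_div_iff₀ hLm h2]
  have h3 : ((L + (a + 1) * m : ℕ) : ℝ) ≤ ((a + 1 : ℕ) : ℝ) * (L + m) := by
    have : L + (a + 1) * m ≤ (a + 1) * (L + m) := by nlinarith
    exact_mod_cast this
  calc Real.log 2 * ((L + (a + 1) * m : ℕ) : ℝ)
      ≤ Real.log 2 * (((a + 1 : ℕ) : ℝ) * (L + m)) := by
        have := Real.log_pos one_lt_two
        gcongr
    _ = ((a + 1 : ℕ) : ℝ) * Real.log 2 * (L + m) := by ring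
    _ ≤ _ := by gcongr

/-- The pseudo orbit that follows `c` for `L` steps and then runs through loops `u b` of length `m`
in the order prescribed by `s`. -/
lemma isPseudoOrbit_concat_loops {δ : ℝ} {p : X} {c : ℕ → X} {L m : ℕ} {u : Bool → ℕ → X}
    (hc : IsDeltaChain f δ c L) (hcL : c L = p) (hm : 1 ≤ m)
    (hu : ∀ b, IsDeltaChain f δ (u b) m) (hu0 : ∀ b, u b 0 = p) (hum : ∀ b, u b m = p)
    (s : ℕ → Bool) :
    IsPseudoOrbit f δ (concatChain c L fun i => u (s (i / m)) (i % m)) := by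
  intro i
  rcases lt_or_ge i L with hi | hi
  · rw [concatChain_of_lt hi, concatChain_of_le (by simp [hcL, hu0]) hi]
    exact hc i hi
  · obtain ⟨t, rfl⟩ := Nat.exists_eq_add_of_le hi
    rw [concatChain_add, add_assoc, concatChain_add]
    have hlt : t % m < m := Nat.mod_lt _ hm
    have hstep := hu (s (t / m)) (t % m) hlt
    rcases Nat.lt_or_ge (t % m + 1) m with h | h
    · have hq : (t + 1) / m = t / m ∧ (t + 1) % m = t % m + 1 :=
        (Nat.div_mod_unique hm).2 ⟨by have := Nat.mod_add_div t m; omega, h⟩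
      rwa [hq.1, hq.2]
    · have hEq : t % m + 1 = m := by omega
      have hq : (t + 1) / m = t / m + 1 ∧ (t + 1) % m = 0 :=
        (Nat.div_mod_unique hm).2 ⟨by have := Nat.mod_add_div t m; rw [mul_add]; omega, hm⟩
      rw [hEq, hum] at hstep
      rwa [hq.1, hq.2, hu0]

/-- Failure of chain continuity on a chain component gives two loops of equal length which are
apart at some time. -/
lemma exists_loops_apart {z : X} {ε : ℝ}
    (h : ∀ δ > 0, ∃ ξ η : ℕ → X, IsPseudoOrbit f δ ξ ∧ IsPseudoOrbit f δ η ∧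
      (∀ i, ξ i ∈ chainClass f z) ∧ (∀ i, η i ∈ chainClass f z) ∧ ξ 0 = η 0 ∧
      ∃ i, ε < dist (ξ i) (η i)) {δ : ℝ} (hδ : 0 < δ) :
    ∃ p ∈ chainClass f z, ∃ (u : Bool → ℕ → X) (m n : ℕ), n < m ∧
      (∀ b, IsDeltaChain f δ (u b) m ∧ u b 0 = p ∧ u b m = p) ∧
      ε < dist (u true n) (u false n) := by
  obtain ⟨ξ, η, hξ, hη, hξC, hηC, h0, n, hn⟩ := h δ hδ
  have hback : ∀ ζ : ℕ → X, IsPseudoOrbit f δ ζ → (∀ i, ζ i ∈ chainClass f z) → ζ 0 = ξ 0 →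
      ∃ (v : ℕ → X) (k : ℕ), n < k ∧ IsDeltaChain f δ v k ∧ v 0 = ξ 0 ∧ v k = ξ 0 ∧
        v n = ζ n := by
    intro ζ hζ hζC hζ0
    obtain ⟨d, k, hk, hd, hd0, hdk⟩ := ((hζC n).2.2.trans (hξC 0).2.1) δ hδ
    refine ⟨concatChain ζ n d, n + k, by omega, IsDeltaChain.concat (fun i _ => hζ i) hd hd0.symm,
      ?_, (concatChain_add _ _ _ _).trans hdk, concatChain_of_le hd0.symm le_rfl⟩
    rw [concatChain_of_le hd0.symm (Nat.zero_le n), hζ0]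
  obtain ⟨v, k, hk, hv, hv0, hvk, hvn⟩ := hback ξ hξ hξC rfl
  obtain ⟨w, l, hl, hw, hw0, hwl, hwn⟩ := hback η hη hηC h0.symm
  refine ⟨ξ 0, hξC 0,
    fun b => if b then concatChain v k w else concatChain w l v, k + l, n, by omega, ?_, ?_⟩
  · intro b
    cases b
    · simp only [Bool.false_eq_true, if_false]
      refine ⟨?_, ?_, ?_⟩
      · rw [add_comm]
        exact hw.concat hv (hwl.trans hv0.symm)
      · rw [concatChain_of_lt (by omega), hw0]
      · rw [add_comm, concatChain_add, hvk]
    · simp only [if_true]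
      refine ⟨hv.concat hw (hvk.trans hw0.symm), ?_, ?_⟩
      · rw [concatChain_of_lt (by omega), hv0]
      · rw [concatChain_add, hwl]
  · simpa [concatChain_of_lt hk, concatChain_of_lt hl, hvn, hwn] using hn

/-- A shadowable point reaching a chain component with apart loops is an entropy point. -/
lemma mem_entR_of_loops [CompactSpace X] (hf : Continuous f) {x z : X} (hx : ShadowablePt f x)
    (hzx : chainClass f z ⊆ CSet f x) {ε : ℝ} (hε : 0 < ε)
    (h : ∀ δ > 0, ∃ p ∈ chainClass f z, ∃ (u : Bool → ℕ → X) (m n : ℕ), n < m ∧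
      (∀ b, IsDeltaChain f δ (u b) m ∧ u b 0 = p ∧ u b m = p) ∧
      ε < dist (u true n) (u false n)) : x ∈ EntR f (ε / 2) := by
  intro K _ hK
  obtain ⟨ρ, hρ, hball⟩ := Metric.nhds_basis_closedBall.mem_iff.1 hK
  obtain ⟨δ, hδ, hsh⟩ := hx (min ρ (ε / 4)) (lt_min hρ (by positivity))
  obtain ⟨p, hp, u, m, n, hnm, hu, hn⟩ := h δ hδ
  have hxp : ChainReach f x p := by
    rcases hzx hp with rfl | hxp
    · exact hp.1
    · exact hxp
  obtain ⟨c, L, hL, hc, hc0, hcL⟩ := hxp δ hδ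
  have hm : 1 ≤ m := by omega
  set ξ : (ℕ → Bool) → ℕ → X := fun s => concatChain c L fun i => u (s (i / m)) (i % m) with hξdef
  choose y hy using fun s : ℕ → Bool => hsh (ξ s)
    (isPseudoOrbit_concat_loops hc hcL hm (fun b => (hu b).1) (fun b => (hu b).2.1)
      (fun b => (hu b).2.2) s) ((concatChain_of_lt hL).trans hc0)
  have hsep : ∀ (s t : ℕ → Bool) (j : ℕ), s j ≠ t j →
      ε / 2 < dist (f^[L + (m * j + n)] (y s)) (f^[L + (m * j + n)] (y t)) := by
    intro s t j hst
    have hval : ∀ s : ℕ → Bool, ξ s (L + (m * j + n)) = u (s j) n := by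
      intro s
      have hq : (m * j + n) / m = j ∧ (m * j + n) % m = n :=
        (Nat.div_mod_unique hm).2 ⟨add_comm _ _, hnm⟩
      simp only [hξdef, concatChain_add, hq.1, hq.2]
    have h1 := (hy s (L + (m * j + n))).trans (min_le_right _ _)
    have h2 := (hy t (L + (m * j + n))).trans (min_le_right _ _)
    rw [hval] at h1 h2
    have h3 : ε < dist (u (s j) n) (u (t j) n) := by
      cases hs : s j <;> cases ht : t j <;> simp_all [dist_comm]
    have h4 := dist_triangle4_left (f^[L + (m * j + n)] (y s))
      (f^[L + (m * j + n)] (y t)) (u (s j) n) (u (t j) n)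
    linarith
  refine entH_pos_of_sepNum_ge (L := L) hm fun N => ?_
  classical
  set Y : (Fin N → Bool) → X := fun s => y fun i => if hi : i < N then s ⟨i, hi⟩ else false
   
  have hY : ∀ s t : Fin N → Bool, s ≠ t →
      ∃ i < L + N * m, ε / 2 < dist (f^[i] (Y s)) (f^[i] (Y t)) := by
    intro s t hst
    obtain ⟨j, hj⟩ := Function.ne_iff.1 hst
    refine ⟨L + (m * j + n), ?_, hsep _ _ j (by simpa using hj)⟩
    have : (j.1 + 1) * m ≤ N * m := Nat.mul_le_mul_right m j.2
    nlinarith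
  have hYinj : Function.Injective Y := by
    intro s t hst
    by_contra hne
    obtain ⟨i, -, hi⟩ := hY s t hne
    rw [hst, dist_self] at hi
    linarith
  refine le_csSup (bddAbove_card_separated hf K _ (half_pos hε))
    ⟨Finset.univ.image Y, ?_, ?_, by simp [Finset.card_image_of_injective _ hYinj]⟩
  · intro w hw
    obtain ⟨s, -, rfl⟩ := Finset.mem_image.1 (Finset.mem_coe.1 hw)
    refine hball ?_
    have h0 := (hy (fun i => if hi : i < N then s ⟨i, hi⟩ else false) 0).trans (min_le_left _ _)
    have hξ0 : ξ (fun i => if hi : i < N then s ⟨i, hi⟩ else false) 0 = x :=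
      (concatChain_of_lt hL).trans hc0
    rwa [hξ0] at h0
  · intro a ha b hb hab
    obtain ⟨s, -, rfl⟩ := Finset.mem_image.1 ha
    obtain ⟨t, -, rfl⟩ := Finset.mem_image.1 hb
    exact hY s t fun hst => hab (by rw [hst])

/-- If all chain components in `C(x)` are chain continuous, then `x` is not an entropy point. -/
lemma notMem_entR_of_chainContinuousOn [CompactSpace X] (hf : Continuous f) {x : X}
    (h : ∀ z ∈ CSet f x, z ∈ CR f → ChainContinuousOn f (chainClass f z)) {r : ℝ} (hr : 0 < r) :
    x ∉ EntR f r := by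
  choose! ρ hρ hclose using fun z (hz : z ∈ CSet f x) => exists_ball_orbits_close hf (h z hz) hr
  obtain ⟨t, htC, ht⟩ := (isClosed_cSet (f := f) x).isCompact.elim_nhds_subcover
    (fun z => Metric.ball z (ρ z)) fun z hz => Metric.ball_mem_nhds z (hρ z hz)
  obtain ⟨R, hR, hmem⟩ := exists_closedBall_orbit_mem hf
    (isOpen_biUnion fun z (_ : z ∈ t) => Metric.isOpen_ball) ht
  intro hx
  refine absurd (hx _ Metric.isClosed_closedBall (Metric.closedBall_mem_nhds x hR)) (not_lt.2 ?_)
  refine entH_le_zero_of_sepNum_le (Fintype.card t) fun n => ?_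
  refine sepNum_le_of_cover (V := fun z : t => Metric.ball z.1 (ρ z.1))
    (fun z => hclose z.1 (htC z.1 z.2)) (fun y hy n => ?_) n
  obtain ⟨z, hz, hyz⟩ := Set.mem_iUnion₂.1 (hmem y hy n)
  exact ⟨⟨z, hz⟩, hyz⟩

end EntropyLemmas

/-- Theorem 1.1: for `x ∈ Sh(f)`, `x ∈ ⋃_{r>0} Ent_r(f)` iff there is a chain
component `C ⊆ C(x)` such that `f|_C` is not chain continuous. -/
theorem stmt_2 {X : Type*} [MetricSpace X] [CompactSpace X] (f : X → X)
    (hf : Continuous f) (x : X) (hx : ShadowablePt f x) :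
    (∃ r > 0, x ∈ EntR f r) ↔
      ∃ C : Set X, IsChainComponent f C ∧ C ⊆ CSet f x ∧ ¬ ChainContinuousOn f C := by
  constructor
  · rintro ⟨r, hr, hxr⟩
    by_contra! hcon
    exact notMem_entR_of_chainContinuousOn hf (fun z hz hzr =>
      hcon (chainClass f z) ⟨z, hzr, rfl⟩ (chainClass_subset_cSet hz)) hr hxr
  · rintro ⟨_, ⟨z, -, rfl⟩, hzx, hcc⟩
    unfold ChainContinuousOn at hcc
    push Not at hcc
    obtain ⟨ε, hε, hcc⟩ := hcc
    exact ⟨ε / 2, half_pos hε, mem_entR_of_loops hf hx hzx hε fun δ hδ =>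
      exists_loops_apart hcc hδ⟩
end

section
/- Let (X,d) be a compact metric space, f : X → X a continuous map, x ∈ X, and C a chain component of f with ω(x,f) ⊆ C. If ω(x,f) is not a minimal set for f, then f|_C : C → C is not chain continuous. -/
open Filter Topology Set

/-- Points of the ω-limit set are the cluster points of the forward orbit. -/
theorem mem_omegaLim_iff_mapClusterPt {X : Type*} [MetricSpace X] {f : X → X} {x y : X} :
    y ∈ omegaLim f x ↔ MapClusterPt y atTop (fun n : ℕ => f^[n] x) := by
  constructor
  · rintro ⟨φ, hφ, h⟩
    exact MapClusterPt.of_comp hφ.tendsto_atTop h.mapClusterPt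
  · intro h
    exact h.tendsto_subseq

theorem isClosed_omegaLim {X : Type*} [MetricSpace X] (f : X → X) (x : X) :
    IsClosed (omegaLim f x) := by
  have h : omegaLim f x = {y | ClusterPt y (map (fun n : ℕ => f^[n] x) atTop)} :=
    Set.ext fun _ => mem_omegaLim_iff_mapClusterPt
  rw [h]
  exact isClosed_setOfPred_clusterPt

theorem mapsTo_omegaLim {X : Type*} [MetricSpace X] {f : X → X} (hf : Continuous f) (x : X) :
    MapsTo f (omegaLim f x) (omegaLim f x) := by
  rintro y ⟨φ, hφ, h⟩
  refine ⟨fun j => φ j + 1, fun i j hij => Nat.succ_lt_succ (hφ hij), ?_⟩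
  simpa only [Function.iterate_succ_apply', Function.comp_def] using (hf.tendsto y).comp h

/-- In a compact space, the forward orbit eventually stays close to its ω-limit set. -/
theorem eventually_exists_mem_omegaLim_dist_lt {X : Type*} [MetricSpace X] [CompactSpace X]
    (f : X → X) (x : X) {η : ℝ} (hη : 0 < η) :
    ∀ᶠ n : ℕ in atTop, ∃ z ∈ omegaLim f x, dist (f^[n] x) z < η := by
  have key : ∀ᶠ n : ℕ in atTop, f^[n] x ∈ Metric.thickening η (omegaLim f x) := by
    by_contra h
    obtain ⟨z, hz, hcl⟩ :=
      (Metric.isOpen_thickening (δ := η) (E := omegaLim f x)).isClosed_compl.isCompact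
        |>.exists_mapClusterPt_of_frequently (not_eventually.mp h)
    exact hz (Metric.self_subset_thickening hη _ (mem_omegaLim_iff_mapClusterPt.mpr hcl))
  filter_upwards [key] with n hn
  exact Metric.mem_thickening_iff.mp hn

/-- Internal chain transitivity of ω-limit sets. -/
theorem exists_isPseudoOrbit_omegaLim {X : Type*} [MetricSpace X] [CompactSpace X] {f : X → X}
    (hf : Continuous f) {x s y : X} (hs : s ∈ omegaLim f x) (hy : y ∈ omegaLim f x)
    {δ : ℝ} (hδ : 0 < δ) :
    ∃ ξ : ℕ → X, IsPseudoOrbit f δ ξ ∧ (∀ i, ξ i ∈ omegaLim f x) ∧ ξ 0 = s ∧ ∃ k, ξ k = y := by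
  obtain ⟨η₀, hη₀, hunif⟩ := Metric.uniformContinuous_iff.mp
    (CompactSpace.uniformContinuous_of_continuous hf) (δ / 2) (half_pos hδ)
  set η := min η₀ (δ / 2)
  have hη : 0 < η := lt_min hη₀ (half_pos hδ)
  have hstep : ∀ a b c : X, dist a b < η → dist (f a) c < η → dist (f b) c ≤ δ := by
    intro a b c hab hac
    have h₁ := hunif (hab.trans_le (min_le_left _ _))
    have h₂ := hac.trans_le (min_le_right _ _)
    linarith [dist_triangle_left (f b) c (f a)]
  obtain ⟨N, hN⟩ := eventually_atTop.mp (eventually_exists_mem_omegaLim_dist_lt f x hη)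
  have : Nonempty X := ⟨x⟩
  choose! p hpmem hpdist using hN
  have hvisit : ∀ z ∈ omegaLim f x, ∀ n₀, ∃ n ≥ n₀, dist (f^[n] x) z < η := by
    intro z hz n₀
    exact frequently_atTop.mp
      ((mem_omegaLim_iff_mapClusterPt.mp hz).frequently (Metric.ball_mem_nhds z hη)) n₀
  obtain ⟨n, hnN, hns⟩ := hvisit s hs N
  obtain ⟨m, hmn, hmy⟩ := hvisit y hy (n + 1)
  obtain ⟨k, rfl⟩ := Nat.exists_eq_add_of_le hmn
  let c : ℕ → X := fun i => if i = 0 then s else if i < k + 1 then p (n + i) else y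
  have hc : ∀ i ≤ k + 1, dist (f^[n + i] x) (c i) < η := by
    intro i hi
    simp only [c]
    split_ifs with h₀ h₁
    · subst h₀
      exact hns
    · exact hpdist _ (by omega)
    · obtain rfl : i = k + 1 := by omega
      rwa [show n + (k + 1) = n + 1 + k by omega]
  have hinv : ∀ j, f^[j] y ∈ omegaLim f x := fun j => (mapsTo_omegaLim hf x).iterate j hy
  refine ⟨fun i => if i < k + 1 then c i else f^[i - (k + 1)] y, ?_, ?_, by simp [c],
    k + 1, by simp⟩
  · intro i
    rcases lt_or_ge i (k + 1) with hi | hi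
    · have hnext : (if i + 1 < k + 1 then c (i + 1) else f^[i + 1 - (k + 1)] y) = c (i + 1) := by
        split_ifs with h
        · rfl
        · obtain rfl : i = k := by omega
          simp [c]
      simp only [hnext, if_pos hi]
      refine hstep _ _ _ (hc i hi.le) ?_
      rw [← Function.iterate_succ_apply' f]
      exact hc (i + 1) hi
    · simp only [if_neg hi.not_gt, if_neg (show ¬ i + 1 < k + 1 by omega),
        Nat.sub_add_comm hi, Function.iterate_succ_apply', dist_self, hδ.le]
  · intro i
    simp only [c]
    split_ifs with h₁ h₀
    · exact hs
    · exact hpmem _ (by omega)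
    · exact hinv _

/-- Theorem 1.3 (3): if `ω(x,f)` is not a minimal set for `f`, then `f|_C` is not
chain continuous. -/
theorem stmt_6 {X : Type*} [MetricSpace X] [CompactSpace X] (f : X → X)
    (hf : Continuous f) (x : X) (C : Set X) (hC : IsChainComponent f C)
    (hω : omegaLim f x ⊆ C) (hmin : ¬ IsMinimalSet f (omegaLim f x)) :
    ¬ ChainContinuousOn f C := by
  intro hcc
  refine hmin ⟨isClosed_omegaLim f x, mapsTo_omegaLim hf x, fun S hS hScl hSinv => ?_⟩
  refine S.eq_empty_or_nonempty.imp_right fun ⟨s, hs⟩ => hS.antisymm fun y hy => ?_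
  rw [← hScl.closure_eq, Metric.mem_closure_iff]
  intro ε hε
  obtain ⟨δ, hδ, hclose⟩ := hcc (ε / 2) (half_pos hε)
  obtain ⟨ξ, hξ, hξmem, hξ₀, k, rfl⟩ := exists_isPseudoOrbit_omegaLim hf (hS hs) hy hδ
  have horb : ∀ i, f^[i] s ∈ S := fun i => hSinv.iterate i hs
  refine ⟨f^[k] s, horb k, ?_⟩
  have hdist := hclose ξ (fun i => f^[i] s) hξ
    (fun i => by simp only [Function.iterate_succ_apply', dist_self, hδ.le])
    (fun i => hω (hξmem i)) (fun i => hω (hS (horb i))) hξ₀ k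
  exact hdist.trans_lt (half_lt_self hε)
end

section
/- Let (X,d) be a compact metric space and f : X → X a continuous map. Then f restricted to CR(f) is chain continuous if and only if f restricted to CR(f) is an equicontinuous homeomorphism of CR(f) and CR(f) is totally disconnected. -/
open Filter Topology Set

section ChainContinuity

variable {X : Type*} [MetricSpace X] {f : X → X} {S : Set X}

/-- A point that is approximated by both endpoints of arbitrarily fine chains is chain
recurrent. -/
lemma mem_CR_of_approx [CompactSpace X] (hf : Continuous f) {z : X}
    (h : ∀ η > 0, ∃ (c : ℕ → X) (k : ℕ), 1 ≤ k ∧ IsDeltaChain f η c k ∧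
      dist (c 0) z ≤ η ∧ dist (c k) z ≤ η) : z ∈ CR f := by
  intro δ hδ
  obtain ⟨ρ, hρ, hfρ⟩ := Metric.uniformContinuous_iff.1
    (CompactSpace.uniformContinuous_of_continuous hf) (δ / 3) (by positivity)
  obtain ⟨c, k, hk, hc, h0, h1⟩ := h (min (ρ / 2) (δ / 3)) (by positivity)
  have hmin₁ := min_le_left (ρ / 2) (δ / 3)
  have hmin₂ := min_le_right (ρ / 2) (δ / 3)
  set c' : ℕ → X := fun i => if i = 0 ∨ i = k then z else c i with hc'
  have hcc' : ∀ i, dist (c i) (c' i) ≤ min (ρ / 2) (δ / 3) := by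
    intro i
    simp only [hc']
    split_ifs with hi
    · rcases hi with rfl | rfl <;> assumption
    · rw [dist_self]; positivity
  refine ⟨c', k, hk, fun i hi => ?_, by simp [hc'], by simp [hc']⟩
  have e₁ : dist (f (c' i)) (f (c i)) < δ / 3 := by
    apply hfρ
    rw [dist_comm]
    linarith [hcc' i]
  have e₂ := hc i hi
  have e₃ := hcc' (i + 1)
  linarith [dist_triangle4 (f (c' i)) (f (c i)) (c (i + 1)) (c' (i + 1))]

lemma isClosed_CR [CompactSpace X] (hf : Continuous f) : IsClosed (CR f) := by
  refine isClosed_of_closure_subset fun z hz => mem_CR_of_approx hf fun η hη => ?_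
  obtain ⟨x, hx, hzx⟩ := Metric.mem_closure_iff.1 hz η hη
  obtain ⟨c, k, hk, hc, h0, h1⟩ := hx η hη
  rw [dist_comm] at hzx
  exact ⟨c, k, hk, hc, h0 ▸ hzx.le, h1 ▸ hzx.le⟩

lemma mapsTo_CR [CompactSpace X] (hf : Continuous f) : MapsTo f (CR f) (CR f) := by
  intro x hx δ hδ
  obtain ⟨ρ, hρ, hfρ⟩ := Metric.uniformContinuous_iff.1
    (CompactSpace.uniformContinuous_of_continuous hf) δ hδ
  obtain ⟨c, k, hk, hc, h0, h1⟩ := hx (ρ / 2) (by positivity)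
  exact ⟨f ∘ c, k, hk, fun i hi => (hfρ ((hc i hi).trans_lt (half_lt_self hρ))).le, by simp [h0], by simp [h1]⟩

lemma surjOn_CR [CompactSpace X] (hf : Continuous f) : SurjOn f (CR f) (CR f) := by
  intro x hx
  choose c k hk hc h0 h1 using fun n : ℕ => hx (1 / ((n : ℝ) + 1)) Nat.one_div_pos_of_nat
  obtain ⟨z, φ, hφ, hz⟩ := CompactSpace.tendsto_subseq fun n => c n (k n - 1)
  have hlast : ∀ n, dist (f (c n (k n - 1))) x ≤ 1 / ((n : ℝ) + 1) := fun n => by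
    simpa [Nat.sub_add_cancel (hk n), h1 n] using hc n (k n - 1) (Nat.sub_lt (hk n) one_pos)
  have hsmall := tendsto_one_div_add_atTop_nhds_zero_nat (𝕜 := ℝ)
  have hfz : f z = x := by
    have hlim : Tendsto (fun n => f (c n (k n - 1))) atTop (𝓝 x) :=
      tendsto_iff_dist_tendsto_zero.2 (squeeze_zero (fun _ => dist_nonneg) hlast hsmall)
    exact tendsto_nhds_unique ((hf.tendsto z).comp hz) (hlim.comp hφ.tendsto_atTop)
  refine ⟨z, mem_CR_of_approx hf fun η hη => ?_, hfz⟩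
  obtain ⟨n, hn₁, hn₂⟩ :=
    ((Metric.tendsto_nhds.1 hz η hη).and
      ((hsmall.comp hφ.tendsto_atTop).eventually_lt_const hη)).exists
  have hkn := hk (φ n)
  refine ⟨fun i => if i = 0 then z else c (φ n) (i - 1), k (φ n), hkn, fun i hi => ?_,
    by simpa using hη.le, ?_⟩
  · rcases i with _ | i
    · simp [hfz, h0, hη.le]
    · simpa using (hc (φ n) i (by omega)).trans hn₂.le
  · simpa [Nat.one_le_iff_ne_zero.1 hkn] using hn₁.le

/-- A pair of points of a compact set returns simultaneously under an equicontinuous surjection. -/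
lemma EquicontinuousOnSet.exists_simultaneous_return (he : EquicontinuousOnSet f S)
    (hS : IsCompact S) (hs : SurjOn f S S) {x y : X} (hx : x ∈ S)
    (hy : y ∈ S) {ε : ℝ} (hε : 0 < ε) (N : ℕ) :
    ∃ k ≥ N, dist (f^[k] x) x ≤ ε ∧ dist (f^[k] y) y ≤ ε := by
  have : Nonempty X := ⟨x⟩
  obtain ⟨δ, hδ, hequi⟩ := he ε hε
  set g := Function.invFunOn f S
  have hg : MapsTo g S S := hs.mapsTo_invFunOn
  have hfg : ∀ n, ∀ w ∈ S, f^[n] (g^[n] w) = w := by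
    intro n
    induction n with
    | zero => simp
    | succ n ih =>
      intro w hw
      rw [Function.iterate_succ_apply, Function.iterate_succ_apply',
        hs.rightInvOn_invFunOn (hg.iterate n hw), ih w hw]
  obtain ⟨q, -, φ, hφ, hq⟩ := (hS.prod hS).tendsto_subseq
    (x := fun n => (g^[n] x, g^[n] y)) fun n => ⟨hg.iterate n hx, hg.iterate n hy⟩
  obtain ⟨M, hM⟩ := Metric.cauchySeq_iff'.1 hq.cauchySeq δ hδ
  have hd := hM (M + N) (by omega)
  rw [dist_comm, Prod.dist_eq, max_lt_iff] at hd
  have hφN : φ M + N ≤ φ (M + N) := by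
    simpa [add_comm] using hφ.add_le_nat N M
  obtain ⟨k, hk⟩ := Nat.exists_eq_add_of_le (show φ M ≤ φ (M + N) by omega)
  have key : ∀ w ∈ S, dist (g^[φ M] w) (g^[φ (M + N)] w) < δ → dist (f^[k] w) w ≤ ε := by
    intro w hw hd
    have := hequi _ (hg.iterate _ hw) _ (hg.iterate _ hw) hd.le (φ (M + N))
    rw [hfg _ w hw] at this
    rwa [hk, add_comm, Function.iterate_add_apply, hfg _ w hw] at this
  exact ⟨k, by omega, key x hx hd.1, key y hy hd.2⟩

lemma EquicontinuousOnSet.injOn (he : EquicontinuousOnSet f S) (hS : IsCompact S)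
    (hs : SurjOn f S S) : InjOn f S := by
  intro x hx y hy hxy
  refine eq_of_forall_dist_le fun ε hε => ?_
  obtain ⟨k, hk, h₁, h₂⟩ := he.exists_simultaneous_return hS hs hx hy (half_pos hε) 1
  obtain ⟨k, rfl⟩ := Nat.exists_eq_add_of_le' hk
  rw [Function.iterate_succ_apply] at h₁ h₂
  rw [hxy, dist_comm] at h₁
  linarith [dist_triangle x (f^[k] (f y)) y]

lemma isPseudoOrbit_iterate {δ : ℝ} (hδ : 0 ≤ δ) (x : X) :
    IsPseudoOrbit f δ fun i => f^[i] x := by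
  intro i
  simpa [← Function.iterate_succ_apply' f] using hδ

lemma ChainContinuousOn.equicontinuousOnSet (h : ChainContinuousOn f S) (hm : MapsTo f S S)
    (hs : SurjOn f S S) : EquicontinuousOnSet f S := by
  intro ε hε
  obtain ⟨δ, hδ, hcc⟩ := h ε hε
  refine ⟨δ, hδ, fun x hx y hy hxy i => ?_⟩
  obtain ⟨z, hz, rfl⟩ := hs hx
  have hη : IsPseudoOrbit f δ fun i => if i = 0 then z else f^[i - 1] y := by
    rintro (_ | i)
    · simpa using hxy
    · simpa [← Function.iterate_succ_apply' f] using hδ.le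
  have := hcc _ _ (isPseudoOrbit_iterate hδ.le z) hη (fun i => hm.iterate i hz)
    (fun i => by
      split_ifs
      exacts [hz, hm.iterate _ hy]) (by simp) (i + 1)
  simpa using this

/-- Following a chain of small steps, one can drift from the orbit of one point to that of
another. -/
lemma exists_pseudoOrbit_of_reflTransGen (hm : MapsTo f S S) {δ ρ : ℝ} (hδ : 0 ≤ δ)
    (hequi : ∀ x ∈ S, ∀ y ∈ S, dist x y ≤ ρ → ∀ i : ℕ, dist (f^[i] x) (f^[i] y) ≤ δ)
    {x y : X} (hx : x ∈ S)
    (hxy : Relation.ReflTransGen (fun a b => a ∈ S ∧ b ∈ S ∧ dist a b ≤ ρ) x y) :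
    ∃ (ξ : ℕ → X) (m : ℕ), IsPseudoOrbit f δ ξ ∧ (∀ i, ξ i ∈ S) ∧ ξ 0 = x ∧
      ∀ i ≥ m, ξ i = f^[i] y := by
  induction hxy with
  | refl =>
    exact ⟨_, 0, isPseudoOrbit_iterate hδ x, fun i => hm.iterate i hx, rfl, fun _ _ => rfl⟩
  | @tail b c _ hbc ih =>
    obtain ⟨ξ, m, hξ, hξS, hξ0, hξm⟩ := ih
    obtain ⟨hb, hc, hbc⟩ := hbc
    refine ⟨fun i => if i ≤ m then ξ i else f^[i] c, m + 1, fun i => ?_, fun i => ?_, by simpa,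
      fun i hi => by simp [show ¬ i ≤ m by omega]⟩
    · rcases lt_trichotomy i m with hi | rfl | hi
      · simpa [hi.le, Nat.succ_le_iff.2 hi] using hξ i
      · simpa [hξm i le_rfl, ← Function.iterate_succ_apply' f] using hequi b hb c hc hbc (i + 1)
      · simpa [show ¬ i ≤ m by omega, show ¬ i + 1 ≤ m by omega,
          ← Function.iterate_succ_apply' f] using hδ
    · dsimp only
      split_ifs
      exacts [hξS i, hm.iterate i hc]

lemma IsPreconnected.reflTransGen_dist_le {C : Set X} (hC : IsPreconnected C) (hCS : C ⊆ S)
    {ρ : ℝ} (hρ : 0 < ρ) {x y : X} (hx : x ∈ C) (hy : y ∈ C) :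
    Relation.ReflTransGen (fun a b => a ∈ S ∧ b ∈ S ∧ dist a b ≤ ρ) x y := by
  refine hC.induction₂' _ (fun a ha => ?_) (fun _ _ _ _ _ _ => Relation.ReflTransGen.trans) hx hy
  filter_upwards [self_mem_nhdsWithin, mem_nhdsWithin_of_mem_nhds (Metric.ball_mem_nhds a hρ)]
    with b hb hab
  have hab : dist b a ≤ ρ := (Metric.mem_ball.1 hab).le
  exact ⟨.single ⟨hCS ha, hCS hb, dist_comm b a ▸ hab⟩, .single ⟨hCS hb, hCS ha, hab⟩⟩

lemma ChainContinuousOn.isTotallyDisconnected (h : ChainContinuousOn f S) (hS : IsCompact S)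
    (hm : MapsTo f S S) (hs : SurjOn f S S) : IsTotallyDisconnected S := by
  have he := h.equicontinuousOnSet hm hs
  intro C hCS hC x hx y hy
  refine eq_of_forall_dist_le fun ε hε => ?_
  obtain ⟨δ, hδ, hcc⟩ := h (ε / 3) (by positivity)
  obtain ⟨ρ, hρ, hequi⟩ := he δ hδ
  obtain ⟨ξ, m, hξ, hξS, hξ0, hξm⟩ := exists_pseudoOrbit_of_reflTransGen hm hδ.le hequi (hCS hx)
    (hC.reflTransGen_dist_le hCS hρ hx hy)
  obtain ⟨k, hk, h₁, h₂⟩ := he.exists_simultaneous_return hS hs (hCS hx) (hCS hy)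
    (show 0 < ε / 3 by positivity) m
  have h₃ := hcc _ ξ (isPseudoOrbit_iterate hδ.le x) hξ (fun i => hm.iterate i (hCS hx)) hξS
    (by simpa using hξ0.symm) k
  rw [hξm k hk] at h₃
  rw [dist_comm] at h₁
  linarith [dist_triangle4 x (f^[k] x) (f^[k] y) y]

/-- A compact totally disconnected set has a uniformly locally constant colouring whose colour
classes are small. -/
lemma IsTotallyDisconnected.exists_coloring (hS : IsCompact S) (ht : IsTotallyDisconnected S)
    {ε : ℝ} (hε : 0 < ε) :
    ∃ g : X → ℕ, (∃ δ > 0, ∀ x ∈ S, ∀ y ∈ S, dist x y < δ → g x = g y) ∧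
      ∀ x ∈ S, ∀ y ∈ S, g x = g y → dist x y ≤ ε := by
  classical
  have : CompactSpace S := isCompact_iff_compactSpace.1 hS
  have : TotallyDisconnectedSpace S := totallyDisconnectedSpace_subtype_iff.2 ht
  have hV : {p : S × S | dist p.1 p.2 < ε / 2} ∈ nhdsSet (diagonal S) := by
    rw [nhdsSet_diagonal_eq_uniformity]
    exact Metric.dist_mem_uniformity (half_pos hε)
  obtain ⟨n, g, h, hg, hgh⟩ :=
    (ContinuousMap.id S).exists_finite_approximation_of_mem_nhds_diagonal hV
  have hloc : {p : S × S | g p.1 = g p.2} ∈ uniformity S := by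
    rw [← nhdsSet_diagonal_eq_uniformity]
    refine (IsOpen.mem_nhdsSet ?_).2 ?_
    · exact (isOpen_discrete (diagonal (Fin n))).preimage (hg.prodMap hg)
    · rintro ⟨x, y⟩ (rfl : x = y)
      rfl
  obtain ⟨δ, hδ, hgδ⟩ := Metric.mem_uniformity_dist.1 hloc
  refine ⟨fun x => if hx : x ∈ S then g ⟨x, hx⟩ else 0, ⟨δ, hδ, fun x hx y hy hxy => ?_⟩,
    fun x hx y hy hxy => ?_⟩
  · have : g ⟨x, hx⟩ = g ⟨y, hy⟩ := @hgδ ⟨x, hx⟩ ⟨y, hy⟩ hxy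
    simp [hx, hy, this]
  · have e : g ⟨x, hx⟩ = g ⟨y, hy⟩ := by simpa [hx, hy, Fin.val_inj] using hxy
    have h₁ : dist (⟨x, hx⟩ : S) (h (g ⟨x, hx⟩)) < ε / 2 := hgh ⟨x, hx⟩
    have h₂ : dist (⟨y, hy⟩ : S) (h (g ⟨y, hy⟩)) < ε / 2 := hgh ⟨y, hy⟩
    rw [e] at h₁
    have h₃ := dist_triangle_right (⟨x, hx⟩ : S) ⟨y, hy⟩ (h (g ⟨y, hy⟩))
    rw [Subtype.dist_eq ⟨x, hx⟩ ⟨y, hy⟩] at h₃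
    linarith

lemma EquicontinuousOnSet.chainContinuousOn (he : EquicontinuousOnSet f S) (hS : IsCompact S)
    (hm : MapsTo f S S) (ht : IsTotallyDisconnected S) : ChainContinuousOn f S := by
  intro ε hε
  obtain ⟨g, ⟨ρ, hρ, hgρ⟩, hg⟩ := ht.exists_coloring hS (half_pos hε)
  obtain ⟨δ, hδ, hequi⟩ := he (ρ / 2) (half_pos hρ)
  have key : ∀ ξ : ℕ → X, IsPseudoOrbit f δ ξ → (∀ i, ξ i ∈ S) →
      ∀ i, dist (ξ i) (f^[i] (ξ 0)) ≤ ε / 2 := by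
    intro ξ hξ hξS
    have hcol : ∀ i j, g (f^[j] (ξ i)) = g (f^[j] (f^[i] (ξ 0))) := by
      intro i
      induction i with
      | zero => simp
      | succ i ih =>
        intro j
        rw [Function.iterate_succ_apply', ← Function.iterate_succ_apply f, ← ih (j + 1),
          Function.iterate_succ_apply]
        refine (hgρ _ (hm.iterate j (hm (hξS i))) _ (hm.iterate j (hξS (i + 1))) ?_).symm
        linarith [hequi _ (hm (hξS i)) _ (hξS (i + 1)) (hξ i) j]
    exact fun i => hg _ (hξS i) _ (hm.iterate i (hξS 0)) (hcol i 0)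
  refine ⟨δ, hδ, fun ξ η hξ hη hξS hηS h0 i => ?_⟩
  have h₁ := key ξ hξ hξS i
  have h₂ := key η hη hηS i
  rw [h0] at h₁
  linarith [dist_triangle_right (ξ i) (η i) (f^[i] (η 0))]

end ChainContinuity

/-- Lemma 2.1 ((2) ↔ (3)): `f|_{CR(f)}` is chain continuous iff `f|_{CR(f)}` is an
equicontinuous homeomorphism of `CR(f)` and `CR(f)` is totally disconnected. -/
theorem stmt_8 {X : Type*} [MetricSpace X] [CompactSpace X] (f : X → X)
    (hf : Continuous f) :
    ChainContinuousOn f (CR f) ↔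
      (Set.BijOn f (CR f) (CR f) ∧ EquicontinuousOnSet f (CR f) ∧
        IsTotallyDisconnected (CR f)) := by
  have hS : IsCompact (CR f) := (isClosed_CR hf).isCompact
  have hm := mapsTo_CR hf
  have hs := surjOn_CR hf
  constructor
  · intro h
    have he := h.equicontinuousOnSet hm hs
    exact ⟨⟨hm, he.injOn hS hs, hs⟩, he, h.isTotallyDisconnected hS hm hs⟩
  · rintro ⟨-, he, ht⟩
    exact he.chainContinuousOn hS hm ht
end
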